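/- Let y : [0,∞) → [0,∞) be continuously differentiable and suppose that ∫₀^∞ y(t) dt < ∞ and that there exist constants C > 0 and β > 0 such that y′(t) ≤ C·(y(t) + y(t)^(1+β)) for all t ≥ 0. Then y(t) → 0 as t → ∞. -/

import Mathlib

open Filter MeasureTheory Set

/-- A function integrable on `[0, ∞)` takes values below any `δ > 0` arbitrarily far out. -/
lemma exists_ge_lt_of_integrableOn_Ici {y : ℝ → ℝ} (hint : IntegrableOn y (Ici (0 : ℝ)))
    {A δ : ℝ} (hA : 0 ≤ A) (hδ : 0 < δ) : ∃ a, A ≤ a ∧ y a < δ := by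
  by_contra! h
  have hconst : IntegrableOn (fun _ : ℝ => δ) (Ici A) := by
    refine Integrable.mono' (hint.mono_set (Ici_subset_Ici.2 hA)) aestronglyMeasurable_const ?_
    filter_upwards [ae_restrict_mem measurableSet_Ici] with t ht
    rw [Real.norm_of_nonneg hδ.le]
    exact h t ht
  rw [integrableOn_const_iff] at hconst
  simp [hδ.ne'] at hconst

/-- If `y` is nonnegative and integrable on `[0, ∞)`, and `z ≤ y` is differentiable there with
`z' ≤ C * y`, then `z` is eventually below any positive number. -/
lemma eventually_lt_of_deriv_le_mul_integrable {y z z' : ℝ → ℝ} {C : ℝ} (hC : 0 < C)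
    (hy_nonneg : ∀ t, 0 ≤ t → 0 ≤ y t) (hint : IntegrableOn y (Ici (0 : ℝ)))
    (hzy : ∀ t, 0 ≤ t → z t ≤ y t) (hderiv : ∀ t, 0 ≤ t → HasDerivAt z (z' t) t)
    (hbound : ∀ t, 0 ≤ t → z' t ≤ C * y t) {η : ℝ} (hη : 0 < η) :
    ∀ᶠ t in atTop, z t < η := by
  have hint' : IntegrableOn y (Ioi (0 : ℝ)) := hint.mono_set Ioi_subset_Ici_self
  have hii : ∀ a b : ℝ, 0 ≤ a → 0 ≤ b → IntervalIntegrable y volume a b := fun a b ha hb =>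
    (hint.mono_set fun t ht => (le_min ha hb).trans ht.1).intervalIntegrable
  set δ := η / (1 + C) with hδ_def
  have hδ : 0 < δ := by positivity
  have hlim := intervalIntegral_tendsto_integral_Ioi (0 : ℝ) hint' tendsto_id
  have htail : ∀ᶠ a in atTop, (∫ t in Ioi (0 : ℝ), y t) - δ < ∫ t in (0 : ℝ)..a, y t :=
    hlim.eventually (lt_mem_nhds (by linarith))
  obtain ⟨A, hA⟩ := eventually_atTop.1 htail
  obtain ⟨a, haA, hya⟩ := exists_ge_lt_of_integrableOn_Ici hint (le_max_right A 0) hδ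
  have ha0 : 0 ≤ a := (le_max_right _ _).trans haA
  filter_upwards [eventually_ge_atTop a] with b hab
  have hb0 : 0 ≤ b := ha0.trans hab
  have hgrowth : z b - z a ≤ ∫ t in a..b, C * y t :=
    intervalIntegral.sub_le_integral_of_hasDeriv_right_of_le hab
      (fun t ht => (hderiv t (ha0.trans ht.1)).continuousAt.continuousWithinAt)
      (fun t ht => (hderiv t (ha0.trans ht.1.le)).hasDerivWithinAt)
      ((hint.mono_set fun t ht => ha0.trans ht.1).const_mul C)
      (fun t ht => hbound t (ha0.trans ht.1.le))
  rw [intervalIntegral.integral_const_mul] at hgrowth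
  have hadd := intervalIntegral.integral_add_adjacent_intervals (hii 0 a le_rfl ha0)
    (hii a b ha0 hb0)
  have htotal : ∫ t in (0 : ℝ)..b, y t ≤ ∫ t in Ioi (0 : ℝ), y t := by
    rw [intervalIntegral.integral_of_le hb0]
    refine setIntegral_mono_set hint' ?_ (Ioc_subset_Ioi_self.eventuallyLE)
    filter_upwards [ae_restrict_mem measurableSet_Ioi] with t ht
    exact hy_nonneg t (le_of_lt ht)
  have hsmall : ∫ t in a..b, y t < δ := by
    linarith [hA a ((le_max_left _ _).trans haA)]
  have hη_eq : η = δ + C * δ := by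
    rw [hδ_def]
    field_simp
  linarith [hzy a ha0, mul_lt_mul_of_pos_left hsmall hC]

/-- Let `y : [0,∞) → [0,∞)` be continuously differentiable with `∫₀^∞ y(t) dt < ∞`,
and suppose there are constants `C > 0`, `β > 0` such that
`y′(t) ≤ C·(y(t) + y(t)^(1+β))` for all `t ≥ 0`.
Then `y(t) → 0` as `t → ∞`. -/
theorem stmt_1 (y y' : ℝ → ℝ) (C β : ℝ) (hC : 0 < C) (hβ : 0 < β)
    (hy_nonneg : ∀ t, 0 ≤ t → 0 ≤ y t)
    (hderiv : ∀ t, 0 ≤ t → HasDerivAt y (y' t) t)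
    (hcont : ContinuousOn y' (Ici (0 : ℝ)))
    (hint : IntegrableOn y (Ici (0 : ℝ)))
    (hbound : ∀ t, 0 ≤ t → y' t ≤ C * (y t + y t ^ (1 + β))) :
    Tendsto y atTop (nhds 0) := by
  -- The change of variable `φ` turns the growth bound into `(φ ∘ y)' ≤ C * y`.
  let w : ℝ → ℝ := fun s => (1 + |s| ^ β)⁻¹
  let φ : ℝ → ℝ := fun x => ∫ s in (0 : ℝ)..x, w s
  have hden : ∀ s : ℝ, 0 < 1 + |s| ^ β := fun s => by positivity
  have hw_pos : ∀ s, 0 < w s := fun s => inv_pos.2 (hden s)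
  have hw_le : ∀ s, w s ≤ 1 := fun s =>
    inv_le_one_of_one_le₀ (by linarith [Real.rpow_nonneg (abs_nonneg s) β])
  have hw_cont : Continuous w :=
    (continuous_const.add (continuous_abs.rpow_const fun _ => Or.inr hβ.le)).inv₀
      fun s => (hden s).ne'
  have hφ_deriv : ∀ x, HasDerivAt φ (w x) x := fun x => hw_cont.integral_hasStrictDerivAt 0 x
    |>.hasDerivAt
  have hφ_mono : StrictMono φ := strictMono_of_hasDerivAt_pos hφ_deriv hw_pos
  have hφ_zero : φ 0 = 0 := intervalIntegral.integral_same
  have hφ_le : ∀ x, 0 ≤ x → φ x ≤ x := fun x hx => by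
    simpa using intervalIntegral.integral_mono_on hx (hw_cont.intervalIntegrable 0 x)
      (continuous_const.intervalIntegrable (μ := volume) 0 x) fun s _ => hw_le s
  have hz_bound : ∀ t, 0 ≤ t → w (y t) * y' t ≤ C * y t := fun t ht => by
    have hy := hy_nonneg t ht
    have hpow : y t ^ (1 + β) = y t * |y t| ^ β := by
      rw [abs_of_nonneg hy, Real.rpow_add_of_nonneg hy zero_le_one hβ.le, Real.rpow_one]
    calc w (y t) * y' t ≤ w (y t) * (C * (y t + y t ^ (1 + β))) :=
          mul_le_mul_of_nonneg_left (hbound t ht) (hw_pos _).le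
      _ = w (y t) * (1 + |y t| ^ β) * (C * y t) := by rw [hpow]; ring
      _ = C * y t := by rw [inv_mul_cancel₀ (hden _).ne', one_mul]
  refine tendsto_order.2 ⟨fun c hc => ?_, fun ε hε => ?_⟩
  · filter_upwards [eventually_ge_atTop 0] with t ht
    exact hc.trans_le (hy_nonneg t ht)
  · filter_upwards [eventually_lt_of_deriv_le_mul_integrable hC hy_nonneg hint
      (fun t ht => hφ_le _ (hy_nonneg t ht)) (fun t ht => (hφ_deriv (y t)).comp t (hderiv t ht))
      hz_bound (hφ_zero ▸ hφ_mono hε)] with t ht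
    exact hφ_mono.lt_iff_lt.1 ht
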